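/- If for some admissible exponent α of A the spectral radius r(T_α) = lim_{n→∞} ‖T_α^n‖^{1/n} of the operator T_α on c00(α) is strictly less than 1, then the sequence A is nonuniform exponentially stable. -/

import Mathlib

open Filter Topology

variable {E : Type*} [NormedAddCommGroup E] [NormedSpace ℝ E] [CompleteSpace E]

/-- `evol A n m` is the evolution operator `A(m,n) = A_{m-1} ∘ ⋯ ∘ A_n`
(the identity if `m ≤ n`). -/
def evol (A : ℕ → E →L[ℝ] E) (n : ℕ) : ℕ → E →L[ℝ] E
  | 0 => 1
  | m + 1 => if n ≤ m then A m * evol A n m else 1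

/-- `α` is an admissible exponent for `A`: there is a positive sequence `M` with
`‖A(m,n)‖ ≤ M n * e^{α (m - n)}` for all `m ≥ n`. -/
def IsAdmissible (A : ℕ → E →L[ℝ] E) (α : ℝ) : Prop :=
  ∃ M : ℕ → ℝ, (∀ n, 0 < M n) ∧
    ∀ m n : ℕ, n ≤ m → ‖evol A n m‖ ≤ M n * Real.exp (α * ((m : ℝ) - (n : ℝ)))

/-- The norm `‖x‖_{n,α} = sup_{m ≥ n} e^{-α(m-n)} ‖A(m,n) x‖`. -/
noncomputable def nnorm (A : ℕ → E →L[ℝ] E) (α : ℝ) (n : ℕ) (x : E) : ℝ :=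
  ⨆ m : Set.Ici n, Real.exp (-α * (((m : ℕ) : ℝ) - (n : ℝ))) * ‖evol A n (m : ℕ) x‖

/-- Membership in `c00(α)`: `u 0 = 0` and `‖u n‖_{n,α} → 0`. -/
def MemC00 (A : ℕ → E →L[ℝ] E) (α : ℝ) (u : ℕ → E) : Prop :=
  u 0 = 0 ∧ Tendsto (fun n => nnorm A α n (u n)) atTop (𝓝 0)

/-- The norm `‖u‖_α = sup_n ‖u n‖_{n,α}` on `c00(α)`. -/
noncomputable def cnorm (A : ℕ → E →L[ℝ] E) (α : ℝ) (u : ℕ → E) : ℝ :=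
  ⨆ n, nnorm A α n (u n)

/-- The evolution map `T`: `(Tu)_0 = 0`, `(Tu)_{n+1} = A_n u_n`. -/
def Tmap (A : ℕ → E →L[ℝ] E) (u : ℕ → E) : ℕ → E
  | 0 => 0
  | m + 1 => A m (u m)

/-- `G = T - Id`. -/
def Gmap (A : ℕ → E →L[ℝ] E) (u : ℕ → E) : ℕ → E :=
  fun n => Tmap A u n - u n

/-- The operator norm of a map `S` on the space `c00(α)`. -/
noncomputable def opNormOn (A : ℕ → E →L[ℝ] E) (α : ℝ) (S : (ℕ → E) → ℕ → E) : ℝ :=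
  sInf {c : ℝ | 0 ≤ c ∧ ∀ u, MemC00 A α u → cnorm A α (S u) ≤ c * cnorm A α u}

section Evolution

variable {F : Type*} [NormedAddCommGroup F] [NormedSpace ℝ F]

theorem evol_self (A : ℕ → F →L[ℝ] F) (n : ℕ) : evol A n n = 1 := by
  cases n with
  | zero => rfl
  | succ k => simp [evol]

theorem evol_succ (A : ℕ → F →L[ℝ] F) {n m : ℕ} (h : n ≤ m) :
    evol A n (m + 1) = A m * evol A n m := by
  simp [evol, h]

theorem evol_mul (A : ℕ → F →L[ℝ] F) {n m p : ℕ} (hnm : n ≤ m) (hmp : m ≤ p) :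
    evol A n p = evol A m p * evol A n m := by
  induction p, hmp using Nat.le_induction with
  | base => rw [evol_self, one_mul]
  | succ p hmp ih => rw [evol_succ A (hnm.trans hmp), evol_succ A hmp, ih, mul_assoc]

theorem evol_apply (A : ℕ → F →L[ℝ] F) {n m p : ℕ} (hnm : n ≤ m) (hmp : m ≤ p) (x : F) :
    evol A m p (evol A n m x) = evol A n p x := by
  rw [evol_mul A hnm hmp]; rfl

theorem nnorm_nonneg (A : ℕ → F →L[ℝ] F) (α : ℝ) (n : ℕ) (x : F) : 0 ≤ nnorm A α n x :=
  Real.iSup_nonneg fun _ => by positivity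

theorem nnorm_zero (A : ℕ → F →L[ℝ] F) (α : ℝ) (n : ℕ) : nnorm A α n 0 = 0 := by
  simp [nnorm]

theorem cnorm_nonneg (A : ℕ → F →L[ℝ] F) (α : ℝ) (u : ℕ → F) : 0 ≤ cnorm A α u :=
  Real.iSup_nonneg fun _ => nnorm_nonneg A α _ _

section Admissible

variable {A : ℕ → F →L[ℝ] F} {α : ℝ} {M : ℕ → ℝ}

theorem weighted_norm_evol_le
    (hM : ∀ m n : ℕ, n ≤ m → ‖evol A n m‖ ≤ M n * Real.exp (α * ((m : ℝ) - (n : ℝ))))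
    {n m : ℕ} (h : n ≤ m) (x : F) :
    Real.exp (-α * ((m : ℝ) - (n : ℝ))) * ‖evol A n m x‖ ≤ M n * ‖x‖ := by
  have h1 : ‖evol A n m x‖ ≤ M n * Real.exp (α * ((m : ℝ) - n)) * ‖x‖ :=
    (evol A n m).le_of_opNorm_le (hM m n h) x
  calc _ ≤ Real.exp (-α * ((m : ℝ) - n)) * (M n * Real.exp (α * ((m : ℝ) - n)) * ‖x‖) := by
        gcongr
    _ = (Real.exp (-α * ((m : ℝ) - n)) * Real.exp (α * ((m : ℝ) - n))) * (M n * ‖x‖) := by ring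
    _ = M n * ‖x‖ := by rw [← Real.exp_add]; simp

theorem nnorm_le
    (hM : ∀ m n : ℕ, n ≤ m → ‖evol A n m‖ ≤ M n * Real.exp (α * ((m : ℝ) - (n : ℝ))))
    (n : ℕ) (x : F) : nnorm A α n x ≤ M n * ‖x‖ :=
  have : Nonempty (Set.Ici n) := ⟨⟨n, le_refl n⟩⟩
  ciSup_le fun m => weighted_norm_evol_le hM m.2 x

theorem le_nnorm (hα : IsAdmissible A α) {n m : ℕ} (h : n ≤ m) (x : F) :
    Real.exp (-α * ((m : ℝ) - (n : ℝ))) * ‖evol A n m x‖ ≤ nnorm A α n x := by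
  obtain ⟨M, -, hM⟩ := hα
  refine le_ciSup (f := fun m : Set.Ici n =>
    Real.exp (-α * (((m : ℕ) : ℝ) - (n : ℝ))) * ‖evol A n (m : ℕ) x‖) ?_ ⟨m, h⟩
  exact ⟨M n * ‖x‖, by rintro _ ⟨k, rfl⟩; exact weighted_norm_evol_le hM k.2 x⟩

theorem norm_le_nnorm (hα : IsAdmissible A α) (n : ℕ) (x : F) : ‖x‖ ≤ nnorm A α n x := by
  simpa [evol_self] using le_nnorm hα (le_refl n) x

theorem nnorm_evol_le (hα : IsAdmissible A α) {n m : ℕ} (h : n ≤ m) (x : F) :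
    nnorm A α m (evol A n m x) ≤ Real.exp (α * ((m : ℝ) - (n : ℝ))) * nnorm A α n x := by
  have : Nonempty (Set.Ici m) := ⟨⟨m, le_refl m⟩⟩
  refine ciSup_le fun p => ?_
  have hp : m ≤ (p : ℕ) := p.2
  rw [evol_apply A h hp]
  calc _ = Real.exp (α * ((m : ℝ) - n)) *
        (Real.exp (-α * (((p : ℕ) : ℝ) - n)) * ‖evol A n (p : ℕ) x‖) := by
        rw [← mul_assoc, ← Real.exp_add]; ring_nf
    _ ≤ _ := by gcongr; exact le_nnorm hα (h.trans hp) x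

theorem nnorm_le_cnorm {u : ℕ → F} (hu : MemC00 A α u) (n : ℕ) :
    nnorm A α n (u n) ≤ cnorm A α u :=
  le_ciSup (f := fun n => nnorm A α n (u n)) hu.2.bddAbove_range n

end Admissible

theorem iterate_Tmap_add (A : ℕ → F →L[ℝ] F) (u : ℕ → F) (k n : ℕ) :
    (Tmap A)^[k] u (n + k) = evol A n (n + k) (u n) := by
  induction k with
  | zero => simp [evol_self]
  | succ k ih =>
    rw [Function.iterate_succ_apply', ← add_assoc, evol_succ A (Nat.le_add_right n k)]
    simp [Tmap, ih]

theorem iterate_Tmap_of_lt (A : ℕ → F →L[ℝ] F) (u : ℕ → F) {k n : ℕ} (h : n < k) :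
    (Tmap A)^[k] u n = 0 := by
  induction k generalizing n with
  | zero => omega
  | succ k ih =>
    rw [Function.iterate_succ_apply']
    cases n with
    | zero => rfl
    | succ n => simp [Tmap, ih (Nat.lt_of_succ_lt_succ h)]

theorem cnorm_iterate_Tmap_le {A : ℕ → F →L[ℝ] F} {α : ℝ} (hα : IsAdmissible A α) (k : ℕ)
    {u : ℕ → F} (hu : MemC00 A α u) :
    cnorm A α ((Tmap A)^[k] u) ≤ Real.exp (α * k) * cnorm A α u := by
  refine ciSup_le fun n => ?_
  rcases lt_or_ge n k with h | h
  · rw [iterate_Tmap_of_lt A u h, nnorm_zero]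
    exact mul_nonneg (Real.exp_nonneg _) (cnorm_nonneg A α u)
  · obtain ⟨n, rfl⟩ := Nat.exists_eq_add_of_le' h
    rw [iterate_Tmap_add]
    refine (nnorm_evol_le hα (Nat.le_add_right n k) _).trans ?_
    rw [show ((n + k : ℕ) : ℝ) - n = k by push_cast; ring]
    gcongr
    exact nnorm_le_cnorm hu n

theorem nnorm_single_of_ne (A : ℕ → F →L[ℝ] F) (α : ℝ) {n m : ℕ} (h : m ≠ n) (x : F) :
    nnorm A α m ((Pi.single n x : ℕ → F) m) = 0 := by
  rw [Pi.single_eq_of_ne h, nnorm_zero]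

theorem memC00_single (A : ℕ → F →L[ℝ] F) (α : ℝ) {n : ℕ} (hn : n ≠ 0) (x : F) :
    MemC00 A α (Pi.single n x) := by
  refine ⟨Pi.single_eq_of_ne hn.symm _, tendsto_const_nhds.congr' ?_⟩
  filter_upwards [eventually_gt_atTop n] with m hm
  exact (nnorm_single_of_ne A α hm.ne' x).symm

theorem cnorm_single_le (A : ℕ → F →L[ℝ] F) (α : ℝ) (n : ℕ) (x : F) :
    cnorm A α (Pi.single n x) ≤ nnorm A α n x := by
  refine ciSup_le fun m => ?_
  rcases eq_or_ne m n with rfl | h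
  · rw [Pi.single_eq_same]
  · rw [nnorm_single_of_ne A α h]
    exact nnorm_nonneg A α n x

/-- A bound for `T^k` on `c00(α)` is a bound for every `A(n+k,n)`, `n ≠ 0`, from `‖·‖_{n,α}` to
`‖·‖_{n+k,α}`. -/
theorem nnorm_evol_add_le {A : ℕ → F →L[ℝ] F} {α : ℝ} {k : ℕ} {c : ℝ} (hc0 : 0 ≤ c)
    (hc : ∀ u, MemC00 A α u → cnorm A α ((Tmap A)^[k] u) ≤ c * cnorm A α u)
    {n : ℕ} (hn : n ≠ 0) (x : F) :
    nnorm A α (n + k) (evol A n (n + k) x) ≤ c * nnorm A α n x := by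
  have hu := memC00_single A α hn x
  set u : ℕ → F := Pi.single n x with hu_def
  have hbdd : BddAbove (Set.range fun m => nnorm A α m ((Tmap A)^[k] u m)) := by
    refine ⟨nnorm A α (n + k) ((Tmap A)^[k] u (n + k)), ?_⟩
    rintro _ ⟨m, rfl⟩
    rcases eq_or_ne m (n + k) with rfl | h
    · exact le_rfl
    · have hz : (Tmap A)^[k] u m = 0 := by
        rcases lt_or_ge m k with hm | hm
        · exact iterate_Tmap_of_lt A u hm
        · obtain ⟨p, rfl⟩ := Nat.exists_eq_add_of_le' hm
          have hp : p ≠ n := fun e => h (by rw [e])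
          rw [iterate_Tmap_add, hu_def, Pi.single_eq_of_ne hp, map_zero]
      simp only [hz, nnorm_zero]
      exact nnorm_nonneg A α _ _
  calc nnorm A α (n + k) (evol A n (n + k) x)
      = nnorm A α (n + k) ((Tmap A)^[k] u (n + k)) := by
        rw [iterate_Tmap_add, hu_def, Pi.single_eq_same]
    _ ≤ cnorm A α ((Tmap A)^[k] u) := le_ciSup hbdd (n + k)
    _ ≤ c * cnorm A α u := hc u hu
    _ ≤ c * nnorm A α n x := by gcongr; exact cnorm_single_le A α n x

theorem nnorm_evol_add_mul_le {A : ℕ → F →L[ℝ] F} {α : ℝ} {k : ℕ} {c : ℝ} (hc0 : 0 ≤ c)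
    (hstep : ∀ n : ℕ, n ≠ 0 → ∀ x : F,
      nnorm A α (n + k) (evol A n (n + k) x) ≤ c * nnorm A α n x)
    {n : ℕ} (hn : n ≠ 0) (x : F) (j : ℕ) :
    nnorm A α (n + k * j) (evol A n (n + k * j) x) ≤ c ^ j * nnorm A α n x := by
  induction j with
  | zero => simp [evol_self]
  | succ j ih =>
    have h := hstep (n + k * j) (by omega) (evol A n (n + k * j) x)
    rw [evol_apply A (Nat.le_add_right _ _) (Nat.le_add_right _ _)] at h
    rw [Nat.mul_succ, ← add_assoc]
    calc _ ≤ _ := h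
      _ ≤ c * (c ^ j * nnorm A α n x) := by gcongr
      _ = _ := by ring

/-- Exponential bounds for the starting times `n ≠ 0` extend to `n = 0`. -/
theorem isAdmissible_of_ne_zero {A : ℕ → F →L[ℝ] F} {ν : ℝ} {N : ℕ → ℝ} (hN0 : ∀ n, 0 < N n)
    (hN : ∀ m n : ℕ, n ≠ 0 → n ≤ m →
      ‖evol A n m‖ ≤ N n * Real.exp (ν * ((m : ℝ) - (n : ℝ)))) :
    IsAdmissible A ν := by
  have hK : 0 ≤ N 1 * ‖A 0‖ * Real.exp (-ν) := by have := hN0 1; positivity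
  refine ⟨fun n => if n = 0 then 1 + N 1 * ‖A 0‖ * Real.exp (-ν) else N n, fun n => ?_,
    fun m n hnm => ?_⟩
  · dsimp only
    split_ifs
    · linarith
    · exact hN0 n
  · dsimp only
    split_ifs with h
    · subst h
      rcases Nat.eq_zero_or_pos m with rfl | hm
      · have : ‖(1 : F →L[ℝ] F)‖ ≤ 1 := ContinuousLinearMap.norm_id_le
        simpa [evol_self] using this.trans (le_add_of_nonneg_right hK)
      · have h1 : evol A 0 1 = A 0 := by simp [evol]
        rw [evol_mul A (Nat.zero_le 1) hm, h1]
        calc ‖evol A 1 m * A 0‖ ≤ ‖evol A 1 m‖ * ‖A 0‖ := norm_mul_le _ _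
          _ ≤ N 1 * Real.exp (ν * ((m : ℝ) - (1 : ℕ))) * ‖A 0‖ := by
            gcongr; exact hN m 1 one_ne_zero hm
          _ = N 1 * ‖A 0‖ * Real.exp (-ν) * Real.exp (ν * ((m : ℝ) - (0 : ℕ))) := by
            rw [mul_assoc _ (Real.exp (-ν)), ← Real.exp_add, mul_right_comm]
            push_cast; ring_nf
          _ ≤ _ := by gcongr; linarith
    · exact hN m n h hnm

theorem exists_neg_isAdmissible_of_contraction {A : ℕ → F →L[ℝ] F} {α : ℝ}
    (hα : IsAdmissible A α) {k : ℕ} (hk : k ≠ 0) {c : ℝ} (hc0 : 0 < c) (hc1 : c < 1)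
    (hstep : ∀ n : ℕ, n ≠ 0 → ∀ x : F,
      nnorm A α (n + k) (evol A n (n + k) x) ≤ c * nnorm A α n x) :
    ∃ ν : ℝ, ν < 0 ∧ IsAdmissible A ν := by
  obtain ⟨M, hM0, hM⟩ := id hα
  have hkpos : (0 : ℝ) < k := by exact_mod_cast Nat.pos_of_ne_zero hk
  have hlog : Real.log c < 0 := Real.log_neg hc0 hc1
  refine ⟨Real.log c / k, div_neg_of_neg_of_pos hlog hkpos,
    isAdmissible_of_ne_zero (N := fun n => Real.exp (|α| * k) * Real.exp (-Real.log c) * M n)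
      (fun n => by have := hM0 n; positivity) fun m n hn hnm => ?_⟩
  have hMn := hM0 n
  refine ContinuousLinearMap.opNorm_le_bound _ (by positivity) fun x => ?_
  obtain ⟨d, rfl⟩ := Nat.exists_eq_add_of_le hnm
  set j := d / k
  set i := d % k
  have hd : d = k * j + i := (Nat.div_add_mod d k).symm
  have hik : i ≤ k := (Nat.mod_lt d (Nat.pos_of_ne_zero hk)).le
  have hdR : (d : ℝ) = k * j + i := by exact_mod_cast hd
  have hikR : (i : ℝ) ≤ k := by exact_mod_cast hik
  have hpow : c ^ j ≤ Real.exp (-Real.log c) * Real.exp (Real.log c / k * d) := by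
    rw [← Real.exp_log hc0, ← Real.exp_nat_mul, Real.log_exp, ← Real.exp_add, Real.exp_le_exp]
    have : Real.log c / k * d = Real.log c * j + Real.log c * (i / k) := by
      rw [hdR]; field_simp
    have h1 : (i : ℝ) / k ≤ 1 := (div_le_one hkpos).2 hikR
    nlinarith
  have hexp : Real.exp (α * i) ≤ Real.exp (|α| * k) := by
    rw [Real.exp_le_exp]
    exact mul_le_mul (le_abs_self α) hikR (Nat.cast_nonneg i) (abs_nonneg α)
  have h1 : n ≤ n + k * j := Nat.le_add_right _ _
  have h2 : n + k * j ≤ n + d := by omega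
  have hrem := nnorm_evol_le hα h2 (evol A n (n + k * j) x)
  rw [evol_apply A h1 h2, show ((n + d : ℕ) : ℝ) - (n + k * j : ℕ) = i by
    push_cast; rw [hdR]; ring] at hrem
  calc ‖evol A n (n + d) x‖ ≤ nnorm A α (n + d) (evol A n (n + d) x) := norm_le_nnorm hα _ _
    _ ≤ Real.exp (α * i) * nnorm A α (n + k * j) (evol A n (n + k * j) x) := hrem
    _ ≤ Real.exp (|α| * k) * (c ^ j * nnorm A α n x) :=
      mul_le_mul hexp (nnorm_evol_add_mul_le hc0.le hstep hn x j) (nnorm_nonneg _ _ _ _)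
        (Real.exp_nonneg _)
    _ ≤ Real.exp (|α| * k) *
        (Real.exp (-Real.log c) * Real.exp (Real.log c / k * d) * (M n * ‖x‖)) := by
      have := nnorm_nonneg A α n x
      gcongr
      exact nnorm_le hM n x
    _ = _ := by push_cast; rw [add_sub_cancel_left]; ring

end Evolution

/-- If for some admissible exponent `α` the spectral radius
`r(T_α) = lim_n ‖T_α^n‖^{1/n} < 1`, then `A` is nonuniform exponentially stable. -/
theorem stmt7 (A : ℕ → E →L[ℝ] E) (α : ℝ) (hα : IsAdmissible A α)
    (r : ℝ) (hr : r < 1)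
    (hlim : Tendsto (fun n : ℕ => (opNormOn A α ((Tmap A)^[n])) ^ ((n : ℝ)⁻¹))
      atTop (𝓝 r)) :
    ∃ ν : ℝ, ν < 0 ∧ IsAdmissible A ν := by
  obtain ⟨k, hk, hk0⟩ := ((hlim.eventually_lt_const hr).and (eventually_ne_atTop 0)).exists
  have hlt : opNormOn A α ((Tmap A)^[k]) < 1 := by
    by_contra! h
    exact hk.not_ge (Real.one_le_rpow h (by positivity))
  have hne : {c : ℝ | 0 ≤ c ∧ ∀ u, MemC00 A α u →
      cnorm A α ((Tmap A)^[k] u) ≤ c * cnorm A α u}.Nonempty :=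
    ⟨Real.exp (α * k), Real.exp_nonneg _, fun u hu => cnorm_iterate_Tmap_le hα k hu⟩
  obtain ⟨c, ⟨hc0, hc⟩, hc1⟩ := exists_lt_of_csInf_lt hne hlt
  refine exists_neg_isAdmissible_of_contraction hα hk0 (c := max c (1 / 2)) (by positivity)
    (max_lt hc1 (by norm_num)) fun n hn x => (nnorm_evol_add_le hc0 hc hn x).trans ?_
  exact mul_le_mul_of_nonneg_right (le_max_left _ _) (nnorm_nonneg A α n x)
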